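/- Let (x_k) be generated by the inexact Linear Contracting PPA recursion for the λ-cocoercive operator F with η ∈ (0,1) and β > 0, and suppose F(x_*) = 0. Then (x_k) converges weakly to some x̄ ∈ H with F(x̄) = 0 (weak convergence meaning ⟨x_k, y⟩ → ⟨x̄, y⟩ for every y ∈ H). -/

import Mathlib

open Filter Topology
open scoped InnerProductSpace

lemma aux_real (E D δ w : ℕ → ℝ) (hE : ∀ k, 0 ≤ E k) (hD : ∀ k, 0 ≤ D k) (hδ0 : ∀ k, 0 ≤ δ k)
    (hδ : Summable δ) (hw : ∀ k, w k ^ 2 ≤ 2 * E (k + 1))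
    (h : ∀ k, E (k + 1) + D k ≤ E k + δ k * w k) :
    (∃ l, Tendsto E atTop (𝓝 l)) ∧ Tendsto D atTop (𝓝 0) := by
  set s : ℕ → ℝ := fun k => Real.sqrt (E k) with hs
  have hs0 : ∀ k, 0 ≤ s k := fun k => Real.sqrt_nonneg _
  have hs2 : ∀ k, s k ^ 2 = E k := fun k => Real.sq_sqrt (hE k)
  have hws : ∀ k, w k ≤ 2 * s (k + 1) := fun k => by
    refine le_of_abs_le (abs_le_of_sq_le_sq ?_ (by linarith [hs0 (k + 1)]))
    have := hw k
    have := hE (k + 1)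
    rw [mul_pow, hs2]; linarith
  have hstep : ∀ k, s (k + 1) ≤ s k + 2 * δ k := fun k => by
    by_contra hc
    push Not at hc
    have h1 := h k
    have h2 := mul_le_mul_of_nonneg_left (hws k) (hδ0 k)
    rw [← hs2, ← hs2] at h1
    have h3 := hs0 k
    have h4 := hδ0 k
    have h5 := hs0 (k + 1)
    have h6 := hD k
    nlinarith [mul_nonneg h3 h4]
  have hsum : ∀ k, ∑ i ∈ Finset.range k, δ i ≤ ∑' i, δ i := fun k =>
    hδ.sum_le_tsum _ (fun i _ => hδ0 i)
  have hsb : ∀ k, s k ≤ s 0 + 2 * ∑ i ∈ Finset.range k, δ i := fun k => by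
    induction k with
    | zero => simp
    | succ k ih => rw [Finset.sum_range_succ]; linarith [hstep k]
  set S : ℝ := s 0 + 2 * ∑' i, δ i with hS
  have hsS : ∀ k, s k ≤ S := fun k => by linarith [hsb k, hsum k]
  have hS0 : 0 ≤ S := (hs0 0).trans (hsS 0)
  have hwS : ∀ k, δ k * w k ≤ 2 * S * δ k := fun k => by
    have := mul_le_mul_of_nonneg_left ((hws k).trans (by linarith [hsS (k + 1)] : _ ≤ 2 * S)) (hδ0 k)
    linarith
  set q : ℕ → ℝ := fun k => ∑ i ∈ Finset.range k, δ i with hq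
  have hqt : Tendsto q atTop (𝓝 (∑' i, δ i)) := hδ.hasSum.tendsto_sum_nat
  set u : ℕ → ℝ := fun k => E k + 2 * S * (∑' i, δ i - q k) with hu
  have hu0 : ∀ k, 0 ≤ u k := fun k =>
    add_nonneg (hE k) (mul_nonneg (by linarith) (by have := hsum k; simp only [hq]; linarith))
  have hud : ∀ k, D k ≤ u k - u (k + 1) := fun k => by
    have := h k
    have := hwS k
    have e : q (k + 1) = q k + δ k := Finset.sum_range_succ _ _
    simp only [hu]
    rw [e]; nlinarith
  have hanti : Antitone u := antitone_nat_of_succ_le fun k => by linarith [hud k, hD k]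
  have hconv : Tendsto u atTop (𝓝 (⨅ i, u i)) :=
    tendsto_atTop_ciInf hanti ⟨0, by rintro _ ⟨k, rfl⟩; exact hu0 k⟩
  refine ⟨⟨(⨅ i, u i) - 2 * S * (∑' i, δ i - ∑' i, δ i), ?_⟩, ?_⟩
  · have := hconv.sub ((hqt.const_sub (∑' i, δ i)).const_mul (2 * S))
    refine this.congr fun k => ?_
    simp only [hu]; ring
  · have := hconv.sub (hconv.comp (tendsto_add_atTop_nat 1))
    rw [sub_self] at this
    exact squeeze_zero hD hud this

lemma aux_opial {H : Type*} [NormedAddCommGroup H] [InnerProductSpace ℝ H] [CompleteSpace H]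
    (lam : ℝ) (hlam : 0 < lam) (F : H → H)
    (hF : ∀ x y : H, lam * ‖F x - F y‖ ^ 2 ≤ ⟪F x - F y, x - y⟫_ℝ)
    (x : ℕ → H) (B : ℝ) (hB : ∀ k, ‖x k‖ ≤ B) (hFx : Tendsto (fun k => F (x k)) atTop (𝓝 0))
    (hz : ∀ z, F z = 0 → ∃ l, Tendsto (fun k => ‖x k - z‖ ^ 2) atTop (𝓝 l)) :
    ∃ xb : H, F xb = 0 ∧
      ∀ y : H, Tendsto (fun k => ⟪x k, y⟫_ℝ) atTop (𝓝 ⟪xb, y⟫_ℝ) := by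
  have hU : ∀ U : Ultrafilter ℕ, (U : Filter ℕ) ≤ atTop → ∃ z : H, F z = 0 ∧
      ∀ y : H, Tendsto (fun k => ⟪x k, y⟫_ℝ) U (𝓝 ⟪z, y⟫_ℝ) := by
    intro U hU
    set f : ℕ → WeakDual ℝ H := fun k => StrongDual.toWeakDual (InnerProductSpace.toDual ℝ H (x k))
      with hf
    have hc := WeakDual.isCompact_closedBall (𝕜 := ℝ) (E := H) 0 B
    obtain ⟨w, -, hw⟩ := hc.ultrafilter_le_nhds (U.map f) (by
      have ht : ∀ k, f k ∈ WeakDual.toStrongDual ⁻¹' Metric.closedBall (0 : StrongDual ℝ H) B := by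
        intro k
        simp [hf, hB k]
      rw [le_principal_iff]
      exact Filter.mem_map.2 (Filter.Eventually.of_forall ht))
    have hw' : Tendsto f U (𝓝 w) := hw
    set z : H := (InnerProductSpace.toDual ℝ H).symm (WeakDual.toStrongDual w) with hzdef
    have hweak : ∀ y : H, Tendsto (fun k => ⟪x k, y⟫_ℝ) U (𝓝 ⟪z, y⟫_ℝ) := by
      intro y
      have h1 := ((WeakDual.eval_continuous (𝕜 := ℝ) y).tendsto w).comp hw'
      have h2 : ⟪z, y⟫_ℝ = w y := by
        rw [hzdef, InnerProductSpace.toDual_symm_apply]; rfl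
      rw [h2]
      exact h1
    refine ⟨z, ?_, hweak⟩
    have hFU : Tendsto (fun k => F (x k)) U (𝓝 0) := hFx.mono_left hU
    have h1 : Tendsto (fun k => ⟪F (x k), x k - z⟫_ℝ) U (𝓝 0) := by
      refine squeeze_zero_norm (a := fun k => ‖F (x k)‖ * (B + ‖z‖)) (fun k => ?_) ?_
      · refine (norm_inner_le_norm _ _).trans ?_
        gcongr
        exact (norm_sub_le _ _).trans (by linarith [hB k])
      · simpa using hFU.norm.mul_const (B + ‖z‖)
    have h2 : Tendsto (fun k => ⟪F z, x k - z⟫_ℝ) U (𝓝 0) := by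
      have := (hweak (F z)).sub_const ⟪z, F z⟫_ℝ
      rw [sub_self] at this
      refine this.congr fun k => ?_
      rw [inner_sub_right, real_inner_comm, real_inner_comm z]
    have h3 : Tendsto (fun k => lam * ‖F (x k) - F z‖ ^ 2) U (𝓝 (lam * ‖0 - F z‖ ^ 2)) :=
      ((hFU.sub_const (F z)).norm.pow 2).const_mul lam
    have h4 := le_of_tendsto_of_tendsto' h3 (h1.sub h2) (fun k => by
      rw [← inner_sub_left]; exact hF _ _)
    simp only [zero_sub, norm_neg, sub_zero] at h4
    have h5 : ‖F z‖ ^ 2 ≤ 0 := by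
      by_contra hc
      push Not at hc
      nlinarith
    have h6 : ‖F z‖ = 0 := by nlinarith [norm_nonneg (F z)]
    exact norm_eq_zero.1 h6
  have huniq : ∀ U₁ U₂ : Ultrafilter ℕ, (U₁ : Filter ℕ) ≤ atTop → (U₂ : Filter ℕ) ≤ atTop →
      ∀ z₁ z₂ : H, F z₁ = 0 → F z₂ = 0 →
      (∀ y : H, Tendsto (fun k => ⟪x k, y⟫_ℝ) U₁ (𝓝 ⟪z₁, y⟫_ℝ)) →
      (∀ y : H, Tendsto (fun k => ⟪x k, y⟫_ℝ) U₂ (𝓝 ⟪z₂, y⟫_ℝ)) → z₁ = z₂ := by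
    intro U₁ U₂ hU₁ hU₂ z₁ z₂ hz₁ hz₂ h₁ h₂
    obtain ⟨l₁, hl₁⟩ := hz z₁ hz₁
    obtain ⟨l₂, hl₂⟩ := hz z₂ hz₂
    have hl : Tendsto (fun k => ⟪x k, z₁ - z₂⟫_ℝ) atTop
        (𝓝 ((l₂ - l₁ + (‖z₁‖ ^ 2 - ‖z₂‖ ^ 2)) / 2)) := by
      refine (((hl₂.sub hl₁).add_const (‖z₁‖ ^ 2 - ‖z₂‖ ^ 2)).div_const 2).congr fun k => ?_
      rw [norm_sub_sq_real, norm_sub_sq_real, inner_sub_right]; ring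
    have e1 := tendsto_nhds_unique (h₁ (z₁ - z₂)) (hl.mono_left hU₁)
    have e2 := tendsto_nhds_unique (h₂ (z₁ - z₂)) (hl.mono_left hU₂)
    have e3 : ⟪z₁ - z₂, z₁ - z₂⟫_ℝ = 0 := by rw [inner_sub_left, e1, e2, sub_self]
    exact sub_eq_zero.1 (inner_self_eq_zero.1 e3)
  obtain ⟨z, hFz, hzw⟩ := hU (Ultrafilter.of atTop) (Ultrafilter.of_le _)
  refine ⟨z, hFz, fun y => ?_⟩
  rw [tendsto_iff_ultrafilter]
  intro U hUle
  obtain ⟨z', hFz', hzw'⟩ := hU U hUle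
  have := huniq _ _ (Ultrafilter.of_le _) hUle z z' hFz hFz' hzw hzw'
  rw [this]
  exact hzw' y

/-- one-step energy inequality -/
lemma aux_step {H : Type*} [NormedAddCommGroup H] [InnerProductSpace ℝ H]
    (a b p q V g : H) (τ η β r d : ℝ) (hτ0 : 0 < τ) (hτ1 : τ < 1)
    (hη1 : η < 1) (hη0 : 0 < η) (hr : 0 < r)
    (hab : 0 ≤ ⟪a - b, p - q⟫_ℝ) (hbq : 0 ≤ ⟪b, q⟫_ℝ) (hβ : 0 < β)
    (W : H) (hW : W = (1 / τ) • p - ((1 - τ) / τ) • q) (hg : ‖g‖ ≤ d)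
    (h : (0 : H) = (r / (1 - η * τ)) • a - ((1 - τ) * (r / (1 - η * τ))) • b + (W - V)
      + β • (p - q) + g) :
    (1 / 2 * ‖W‖ ^ 2 + β / 2 * ‖p‖ ^ 2 + r / (1 - η * τ) * ⟪a, p⟫_ℝ) +
      (β / 2 * ‖p - q‖ ^ 2 + τ * (1 - η) * (r * ⟪b, q⟫_ℝ)) ≤
    (1 / 2 * ‖V‖ ^ 2 + β / 2 * ‖q‖ ^ 2 + r * ⟪b, q⟫_ℝ) + d * ‖W‖ := by
  have hρ : 0 < 1 - η * τ := by nlinarith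
  set R := r / (1 - η * τ) with hR
  have hRr : R * (1 - η * τ) = r := by rw [hR]; field_simp
  have hR0 : 0 < R := div_pos hr hρ
  have hRge : r ≤ R := by rw [← hRr]; nlinarith [mul_pos hη0 hτ0]
  have h0 : R * ⟪a, W⟫_ℝ - (1 - τ) * R * ⟪b, W⟫_ℝ + (⟪W, W⟫_ℝ - ⟪V, W⟫_ℝ)
      + β * (⟪p, W⟫_ℝ - ⟪q, W⟫_ℝ) + ⟪g, W⟫_ℝ = 0 := by
    have := congrArg (fun t => ⟪t, W⟫_ℝ) h
    simp only [inner_add_left, inner_sub_left, inner_smul_left, inner_zero_left] at this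
    simp at this
    rw [real_inner_self_eq_norm_sq]
    linarith
  have hgW : -(d * ‖W‖) ≤ ⟪g, W⟫_ℝ := by
    have h1 := abs_real_inner_le_norm g W
    have h2 := mul_le_mul_of_nonneg_right hg (norm_nonneg W)
    linarith [neg_abs_le ⟪g, W⟫_ℝ]
  have hVW : ⟪V, W⟫_ℝ ≤ 1 / 2 * ‖V‖ ^ 2 + 1 / 2 * ‖W‖ ^ 2 := by
    have := norm_sub_sq_real V W
    nlinarith [sq_nonneg ‖V - W‖]
  have hWW : ⟪W, W⟫_ℝ = ‖W‖ ^ 2 := real_inner_self_eq_norm_sq W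
  have ex : ∀ t : H, ⟪t, W⟫_ℝ = (1 / τ) * ⟪t, p⟫_ℝ - ((1 - τ) / τ) * ⟪t, q⟫_ℝ := fun t => by
    rw [hW, inner_sub_right, inner_smul_right, inner_smul_right]
  rw [ex a, ex b, ex p, ex q, hWW] at h0
  have hpp : ⟪p, p⟫_ℝ = ‖p‖ ^ 2 := real_inner_self_eq_norm_sq p
  have hqq : ⟪q, q⟫_ℝ = ‖q‖ ^ 2 := real_inner_self_eq_norm_sq q
  have hqp : ⟪q, p⟫_ℝ = ⟪p, q⟫_ℝ := real_inner_comm p q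
  have hpq := norm_sub_sq_real p q
  have hab' : ⟪a - b, p - q⟫_ℝ = ⟪a, p⟫_ℝ - ⟪a, q⟫_ℝ - ⟪b, p⟫_ℝ + ⟪b, q⟫_ℝ := by
    simp only [inner_sub_left, inner_sub_right]; ring
  rw [hpp, hqq, hqp] at h0
  set c := (1 - τ) / τ with hc
  have hc0 : 0 ≤ c := div_nonneg (by linarith) hτ0.le
  have hc1 : 1 / τ = 1 + c := by rw [hc]; field_simp; ring
  have hct : c * τ = 1 - τ := by rw [hc]; field_simp
  rw [hc1] at h0
  -- F part
  have f1 : R * ((1 + c) * ⟪a, p⟫_ℝ - c * ⟪a, q⟫_ℝ) -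
      (1 - τ) * R * ((1 + c) * ⟪b, p⟫_ℝ - c * ⟪b, q⟫_ℝ)
      = R * ⟪a, p⟫_ℝ - (1 - τ) * R * ⟪b, q⟫_ℝ + R * c * ⟪a - b, p - q⟫_ℝ := by
    rw [hab']
    linear_combination (R * ⟪b, p⟫_ℝ - R * ⟪b, q⟫_ℝ) * hct
  have f2 : (1 - τ) * R * ⟪b, q⟫_ℝ = r * ⟪b, q⟫_ℝ - τ * (1 - η) * R * ⟪b, q⟫_ℝ := by
    rw [← hRr]; ring
  have f3 : τ * (1 - η) * (r * ⟪b, q⟫_ℝ) ≤ τ * (1 - η) * R * ⟪b, q⟫_ℝ := by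
    rw [mul_assoc (τ * (1 - η))]
    exact mul_le_mul_of_nonneg_left (mul_le_mul_of_nonneg_right hRge hbq)
      (mul_nonneg hτ0.le (by linarith))
  have f4 : 0 ≤ R * c * ⟪a - b, p - q⟫_ℝ := by positivity
  have g1 : (1 + c) * ‖p‖ ^ 2 - c * ⟪p, q⟫_ℝ - ((1 + c) * ⟪p, q⟫_ℝ - c * ‖q‖ ^ 2)
     = 1 / 2 * ‖p‖ ^ 2 - 1 / 2 * ‖q‖ ^ 2 + (1 / 2 + c) * ‖p - q‖ ^ 2 := by
    rw [hpq]; ring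
  have g2 : 0 ≤ β * c * ‖p - q‖ ^ 2 := by positivity
  rw [g1] at h0
  nlinarith

theorem linear_contracting_ppa_weak_convergence
    {H : Type*} [NormedAddCommGroup H] [InnerProductSpace ℝ H] [CompleteSpace H]
    (lam : ℝ) (hlam : 0 < lam) (F : H → H)
    (hF : ∀ x y : H, lam * ‖F x - F y‖ ^ 2 ≤ ⟪F x - F y, x - y⟫_ℝ)
    (τ η β : ℝ) (hτ0 : 0 < τ) (hτ1 : τ < 1) (hη0 : 0 < η) (hη1 : η < 1) (hβ : 0 < β)
    (x : ℕ → H)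
    (v : ℕ → H)
    (hv0 : v 0 = (1 / τ) • x 0 - ((1 - τ) / τ) • x 0)
    (hv : ∀ k, v (k + 1) = (1 / τ) • x (k + 1) - ((1 - τ) / τ) • x k)
    (δ : ℕ → ℝ) (hδ0 : ∀ k, 0 ≤ δ k) (hδ : Summable δ)
    (g : ℕ → H) (hg : ∀ k, ‖g k‖ ≤ δ k)
    (hx : ∀ k, (0 : H) = (1 / (1 - η * τ) ^ (k + 1)) • F (x (k + 1)) -
      ((1 - τ) / (1 - η * τ) ^ (k + 1)) • F (x k) + (v (k + 1) - v k) +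
      β • (x (k + 1) - x k) + g k)
    (xs : H) (hxs : F xs = 0) :
    ∃ xb : H, F xb = 0 ∧
      ∀ y : H, Tendsto (fun k => ⟪x k, y⟫_ℝ) atTop (𝓝 ⟪xb, y⟫_ℝ) := by
  have hρ : 0 < 1 - η * τ := by nlinarith
  have hρ1 : 1 - η * τ ≤ 1 := by nlinarith
  set c := (1 - τ) / τ with hc
  have hc1 : 1 / τ = 1 + c := by rw [hc]; field_simp; ring
  have key : ∀ z, F z = 0 →
      (∃ l, Tendsto (fun k => ‖x k - z‖ ^ 2) atTop (𝓝 l)) ∧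
      Tendsto (fun k => ⟪F (x k), x k - z⟫_ℝ) atTop (𝓝 0) := by
    intro z hz
    have hφ : ∀ k, 0 ≤ ⟪F (x k), x k - z⟫_ℝ := fun k => by
      have := hF (x k) z
      rw [hz, sub_zero] at this
      exact le_trans (by positivity) this
    set r : ℕ → ℝ := fun k => 1 / (1 - η * τ) ^ k with hr
    have hr0 : ∀ k, 0 < r k := fun k => by simp only [hr]; positivity
    have hr1 : ∀ k, 1 ≤ r k := fun k => by
      simp only [hr]
      rw [le_div_iff₀ (by positivity), one_mul]
      exact pow_le_one₀ hρ.le hρ1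
    have hrs : ∀ k, r (k + 1) = r k / (1 - η * τ) := fun k => by
      simp only [hr]; rw [pow_succ]; field_simp
    set E : ℕ → ℝ := fun k => 1 / 2 * ‖v k - z‖ ^ 2 + β / 2 * ‖x k - z‖ ^ 2 +
      r k * ⟪F (x k), x k - z⟫_ℝ with hE
    set D : ℕ → ℝ := fun k => β / 2 * ‖x (k + 1) - x k‖ ^ 2 +
      τ * (1 - η) * (r k * ⟪F (x k), x k - z⟫_ℝ) with hD
    have hη' : 0 < 1 - η := by linarith
    have t1 : ∀ k, 0 ≤ r k * ⟪F (x k), x k - z⟫_ℝ := fun k => mul_nonneg (hr0 k).le (hφ k)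
    have hE0 : ∀ k, 0 ≤ E k := fun k => by
      have := t1 k
      simp only [hE]; positivity
    have hD0 : ∀ k, 0 ≤ D k := fun k => by
      have := t1 k
      simp only [hD]; positivity
    have hstep : ∀ k, E (k + 1) + D k ≤ E k + δ k * ‖v (k + 1) - z‖ := fun k => by
      have e : x (k + 1) - x k = (x (k + 1) - z) - (x k - z) := by abel
      have := aux_step (F (x (k + 1))) (F (x k)) (x (k + 1) - z) (x k - z) (v k - z) (g k)
        τ η β (r k) (δ k) hτ0 hτ1 hη1 hη0 (hr0 k)
        (by rw [← e]; exact le_trans (by positivity) (hF _ _)) (hφ k) hβ (v (k + 1) - z)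
        (by rw [hv k, ← hc, hc1]; module) (hg k)
        (by
          rw [hx k, ← hrs, ← e]
          simp only [hr]
          rw [sub_sub_sub_cancel_right, mul_one_div])
      rw [← hrs, ← e] at this
      exact this
    obtain ⟨⟨l, hl⟩, hDt⟩ := aux_real E D δ (fun k => ‖v (k + 1) - z‖) hE0 hD0 hδ0 hδ
      (fun k => by
        have := t1 (k + 1)
        have : 0 ≤ β / 2 * ‖x (k + 1) - z‖ ^ 2 := by positivity
        simp only [hE]; linarith) hstep
    have hrφ : Tendsto (fun k => r k * ⟪F (x k), x k - z⟫_ℝ) atTop (𝓝 0) := by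
      have h1 : Tendsto (fun k => D k / (τ * (1 - η))) atTop (𝓝 0) := by
        simpa using hDt.div_const (τ * (1 - η))
      refine squeeze_zero t1 (fun k => ?_) h1
      rw [le_div_iff₀ (by positivity)]
      have : 0 ≤ β / 2 * ‖x (k + 1) - x k‖ ^ 2 := by positivity
      simp only [hD]; linarith
    have hΔ2 : Tendsto (fun k => ‖x (k + 1) - x k‖ ^ 2) atTop (𝓝 0) := by
      have h1 : Tendsto (fun k => D k / (β / 2)) atTop (𝓝 0) := by
        simpa using hDt.div_const (β / 2)
      refine squeeze_zero (fun k => by positivity) (fun k => ?_) h1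
      rw [le_div_iff₀ (by positivity)]
      have := t1 k
      have : 0 ≤ τ * (1 - η) * (r k * ⟪F (x k), x k - z⟫_ℝ) := by positivity
      simp only [hD]; linarith
    have hΔ : Tendsto (fun k => ‖x (k + 1) - x k‖) atTop (𝓝 0) := by
      have := hΔ2.sqrt
      simpa using this
    obtain ⟨M, hM⟩ := hl.bddAbove_range
    have hM' : ∀ k, ‖x k - z‖ ≤ Real.sqrt (M / (β / 2)) := fun k => by
      apply Real.le_sqrt_of_sq_le
      rw [le_div_iff₀ (by positivity)]
      have h1 : E k ≤ M := hM ⟨k, rfl⟩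
      have h2 := t1 k
      have h3 : 0 ≤ 1 / 2 * ‖v k - z‖ ^ 2 := by positivity
      simp only [hE] at h1
      linarith
    have hcross : Tendsto (fun k => ⟪x (k + 1) - z, x (k + 1) - x k⟫_ℝ) atTop (𝓝 0) := by
      refine squeeze_zero_norm
        (a := fun k => Real.sqrt (M / (β / 2)) * ‖x (k + 1) - x k‖) (fun k => ?_) ?_
      · refine (norm_inner_le_norm _ _).trans ?_
        gcongr
        exact hM' _
      · simpa using hΔ.const_mul (Real.sqrt (M / (β / 2)))
    refine ⟨⟨(l - 0 - c * 0 - c ^ 2 / 2 * 0) / ((1 + β) / 2), ?_⟩, ?_⟩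
    · rw [← tendsto_add_atTop_iff_nat 1]
      have hs := (tendsto_add_atTop_iff_nat 1).2 hl
      have hs' := (tendsto_add_atTop_iff_nat 1).2 hrφ
      refine ((((hs.sub hs').sub (hcross.const_mul c)).sub
        (hΔ2.const_mul (c ^ 2 / 2))).div_const ((1 + β) / 2)).congr fun k => ?_
      have e : v (k + 1) - z = (x (k + 1) - z) + c • (x (k + 1) - x k) := by
        rw [hv k, hc1]; module
      have e2 : ‖v (k + 1) - z‖ ^ 2 = ‖x (k + 1) - z‖ ^ 2 +
          2 * (c * ⟪x (k + 1) - z, x (k + 1) - x k⟫_ℝ) + c ^ 2 * ‖x (k + 1) - x k‖ ^ 2 := by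
        rw [e, norm_add_sq_real, inner_smul_right, norm_smul, mul_pow, Real.norm_eq_abs, sq_abs]
      simp only [hE]
      rw [e2, div_eq_iff (by positivity)]
      ring
    · refine squeeze_zero hφ (fun k => ?_) hrφ
      exact le_mul_of_one_le_left (hφ k) (hr1 k)
  obtain ⟨⟨l, hl⟩, hφ⟩ := key xs hxs
  obtain ⟨M, hM⟩ := hl.bddAbove_range
  refine aux_opial lam hlam F hF x (Real.sqrt M + ‖xs‖) (fun k => ?_) ?_ (fun z hz => (key z hz).1)
  · have h1 : ‖x k - xs‖ ≤ Real.sqrt M := Real.le_sqrt_of_sq_le (hM ⟨k, rfl⟩)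
    have h2 := norm_add_le (x k - xs) xs
    rw [sub_add_cancel] at h2
    linarith
  · rw [tendsto_zero_iff_norm_tendsto_zero]
    have h2 : Tendsto (fun k => ‖F (x k)‖ ^ 2) atTop (𝓝 0) := by
      have h1 : Tendsto (fun k => ⟪F (x k), x k - xs⟫_ℝ / lam) atTop (𝓝 0) := by
        simpa using hφ.div_const lam
      refine squeeze_zero (fun k => by positivity) (fun k => ?_) h1
      rw [le_div_iff₀ hlam]
      have := hF (x k) xs
      rw [hxs, sub_zero] at this
      linarith
    simpa using h2.sqrt
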